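/- For every n ≥ 2, x_{n+1} = x_n r_n + 1 and z_{n+1} = z_n r_n − 2^n − 1. -/

import Mathlib

namespace Paper

/-- `s i = 2^{ν₂(i+1)}`, the largest power of 2 dividing `i+1`. -/
def s (i : ℕ) : ℕ := 2 ^ padicValNat 2 (i + 1)

/-- Continuant numerators, shifted by 2: `p 0 = p_{-2} = 0`, `p 1 = p_{-1} = 1`,
and `p (n+2) = p_n = s_n p_{n-1} + p_{n-2}`. -/
def p : ℕ → ℤ
  | 0 => 0
  | 1 => 1
  | n + 2 => (s n : ℤ) * p (n + 1) + p n

/-- Continuant denominators, shifted by 2: `q 0 = q_{-2} = 1`, `q 1 = q_{-1} = 0`,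
and `q (n+2) = q_n = s_n q_{n-1} + q_{n-2}`. -/
def q : ℕ → ℤ
  | 0 => 1
  | 1 => 0
  | n + 2 => (s n : ℤ) * q (n + 1) + q n

/-- Hurwitz–Kolden–Frame matrix of a finite sequence. -/
def M (l : List ℤ) : Matrix (Fin 2) (Fin 2) ℤ :=
  (l.map fun a => !![a, 1; 1, 0]).prod

/-- `u n = (s_1, s_2, ..., s_{2^n - 3})`. -/
def u (n : ℕ) : List ℤ := (List.range (2 ^ n - 3)).map fun i => (s (i + 1) : ℤ)

/-- `v n = (s_1, s_2, ..., s_{2^n - 2})`. -/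
def v (n : ℕ) : List ℤ := (List.range (2 ^ n - 2)).map fun i => (s (i + 1) : ℤ)

def c (n : ℕ) : ℤ := M (u n) 0 0
def e (n : ℕ) : ℤ := M (u n) 0 1
def d (n : ℕ) : ℤ := M (u n) 1 0
def f (n : ℕ) : ℤ := M (u n) 1 1
def w (n : ℕ) : ℤ := M (v n) 0 0
def y (n : ℕ) : ℤ := M (v n) 0 1
def x (n : ℕ) : ℤ := M (v n) 1 0
def z (n : ℕ) : ℤ := M (v n) 1 1
def g (n : ℕ) : ℤ := c n + 2 * e n + f n
def r (n : ℕ) : ℤ := 2 ^ n * (w n + x n) + w n + y n + z n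

end Paper

open Paper Filter Real

namespace Paper

/-- Adding `2 ^ n` to a positive number below `2 ^ n` does not change its 2-adic valuation. -/
lemma padicValNat_two_pow_add {n k : ℕ} (hk : k ≠ 0) (hkn : k < 2 ^ n) :
    padicValNat 2 (2 ^ n + k) = padicValNat 2 k := by
  obtain ⟨a, m, hm, rfl⟩ := Nat.exists_eq_two_pow_mul_odd hk
  have han : a < n := (Nat.pow_lt_pow_iff_right one_lt_two).1
    ((Nat.le_mul_of_pos_right _ hm.pos).trans_lt hkn)
  have hval (t : ℕ) (ht : Odd t) : padicValNat 2 (2 ^ a * t) = a := by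
    rw [padicValNat.mul (by positivity) ht.pos.ne', padicValNat.prime_pow,
      padicValNat.eq_zero_of_not_dvd ht.not_two_dvd_nat, add_zero]
  have heven : Even (2 ^ (n - a)) := (Nat.even_pow' (by omega)).2 even_two
  rw [hval m hm, ← Nat.add_sub_cancel' han.le, pow_add, ← mul_add, hval _ (heven.add_odd hm)]

lemma s_two_pow_sub_one (n : ℕ) : s (2 ^ n - 1) = 2 ^ n := by
  rw [s, Nat.sub_add_cancel Nat.one_le_two_pow, padicValNat.prime_pow]

lemma s_two_pow_add {n i : ℕ} (hi : i + 1 < 2 ^ n) : s (2 ^ n + i) = s i := by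
  rw [s, s, add_assoc, padicValNat_two_pow_add i.succ_ne_zero hi]

lemma M_append (l₁ l₂ : List ℤ) : M (l₁ ++ l₂) = M l₁ * M l₂ := by
  simp [M]

lemma det_M (l : List ℤ) : (M l).det = (-1) ^ l.length := by
  induction l with
  | nil => simp [M]
  | cons a l ih =>
    rw [← List.singleton_append, M_append, Matrix.det_mul, ih]
    simp [M, Matrix.det_fin_two_of, pow_succ']

/-- The word `v (n + 1)` consists of two copies of `v n` separated by `2 ^ n, 1`. -/
lemma v_succ {n : ℕ} (hn : 1 ≤ n) : v (n + 1) = v n ++ [2 ^ n, 1] ++ v n := by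
  have h2 : 2 ≤ 2 ^ n := Nat.le_self_pow (by omega) 2
  have hlen : 2 ^ (n + 1) - 2 = (2 ^ n - 2) + 2 + (2 ^ n - 2) := by
    rw [pow_succ]; omega
  have hmid : s (2 ^ n - 2 + 1) = 2 ^ n := by
    rw [show 2 ^ n - 2 + 1 = 2 ^ n - 1 by omega, s_two_pow_sub_one]
  have hone : s (2 ^ n - 2 + 1 + 1) = 1 := by
    rw [show 2 ^ n - 2 + 1 + 1 = 2 ^ n + 0 by omega, s_two_pow_add (by omega)]
    simp [s]
  rw [v, v, hlen, List.range_add, List.map_append, List.range_add, List.map_append]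
  congr 1
  · simp [List.range_succ, hmid, hone]
  · rw [List.map_map]
    refine List.map_congr_left fun i hi => ?_
    rw [List.mem_range] at hi
    rw [Function.comp_apply, show 2 ^ n - 2 + 2 + i + 1 = 2 ^ n + (i + 1) by omega,
      s_two_pow_add (by omega)]

lemma det_v {n : ℕ} (hn : 1 ≤ n) : w n * z n - y n * x n = 1 := by
  have heven : Even (v n).length := by
    rw [v, List.length_map, List.length_range]
    exact ((Nat.even_pow' (by omega)).2 even_two).tsub even_two
  rw [w, z, y, x, ← Matrix.det_fin_two, det_M, heven.neg_one_pow]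

end Paper

/-- For n ≥ 2, `x_{n+1} = x_n r_n + 1` and `z_{n+1} = z_n r_n − 2^n − 1`. -/
theorem x_z_succ_eq (n : ℕ) (hn : 2 ≤ n) :
    x (n + 1) = x n * r n + 1 ∧ z (n + 1) = z n * r n - 2 ^ n - 1 := by
  have hdet : w n * z n - y n * x n = 1 := det_v (by omega)
  have hM : M (v (n + 1)) = M (v n) * !![2 ^ n + 1, 2 ^ n; 1, 1] * M (v n) := by
    rw [v_succ (by omega), M_append, M_append]
    simp [M]
  have hx : x (n + 1) =
      (x n * (2 ^ n + 1) + z n) * w n + (x n * 2 ^ n + z n) * x n := by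
    rw [x, hM]
    simp [Matrix.mul_apply, x, z, w]
  have hz : z (n + 1) =
      (x n * (2 ^ n + 1) + z n) * y n + (x n * 2 ^ n + z n) * z n := by
    rw [z, hM]
    simp [Matrix.mul_apply, x, z, y]
  rw [hx, hz, r]
  constructor
  · linear_combination hdet
  · linear_combination -(2 ^ n + 1) * hdet
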